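/- Let T be an incomplete table over schema R, let X, Y ⊆ R, and let σ be the strongly possible functional dependency X →_sp Y. Assume every attribute of T has at least one non-⊥ value and that the submultiset of X-total tuples of T satisfies X →_sp Y. Then g3(σ) ≥ g5(σ). -/

import Mathlib

/- Common framework: incomplete tables, strongly possible worlds and constraints.
   A tuple assigns each attribute a value in `Option V`, with `none` encoding the
   null marker ⊥.  In the degenerate case of an attribute whose active domain is
   empty, the fresh symbol `s` (outside all domains) is encoded by `none` in the
   strongly possible world: it is a single fixed symbol, equal only to itself and
   different from every domain value, exactly as `none` behaves. -/

namespace SPDB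

variable {α V : Type} [DecidableEq α] [DecidableEq V]

/-- A tuple over attribute type `α` with values in `V`; `none` is the null ⊥. -/
abbrev Tuple (α V : Type) := α → Option V

/-- An incomplete table: a finite multiset of tuples. -/
abbrev Table (α V : Type) := Multiset (Tuple α V)

/-- The active domain of attribute `A` in table `T`: the non-null values in column `A`. -/
def VD (T : Table α V) (A : α) : Finset V :=
  (T.filterMap fun t => t A).toFinset

/-- `t'` is a strongly possible extension of `t` w.r.t. the active domains of `T`:
non-null entries are kept, each null is replaced by an active domain value
(by the fresh symbol, encoded `none`, if the active domain is empty). -/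
def spExt (T : Table α V) (t t' : Tuple α V) : Prop :=
  ∀ A, (t A ≠ none → t' A = t A) ∧
       (t A = none → if (VD T A).Nonempty then ∃ v ∈ VD T A, t' A = some v
                     else t' A = none)

/-- `T'` is a strongly possible world of `T`. -/
def spWorld (T T' : Table α V) : Prop := Multiset.Rel (spExt T) T T'

/-- Two tuples agree on the attribute set `X`. -/
def agrees (X : Finset α) (t1 t2 : Tuple α V) : Prop := ∀ A ∈ X, t1 A = t2 A

/-- Weak similarity on the attribute set `X`. -/
def weakSim (X : Finset α) (t1 t2 : Tuple α V) : Prop :=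
  ∀ A ∈ X, t1 A = t2 A ∨ t1 A = none ∨ t2 A = none

/-- `t` is `X`-total: no nulls among the attributes of `X`. -/
def isTotal (X : Finset α) (t : Tuple α V) : Prop := ∀ A ∈ X, t A ≠ none

instance (X : Finset α) : DecidablePred (isTotal (V := V) X) := fun t =>
  decidable_of_iff (∀ A ∈ X, t A ≠ none) Iff.rfl

/-- Projection of a tuple to the attribute set `X` (nulls outside `X`). -/
def proj (X : Finset α) (t : Tuple α V) : Tuple α V :=
  fun A => if A ∈ X then t A else none

/-- A (complete) table satisfies the key `K`: tuple occurrences are pairwise distinct on `K`. -/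
def keyOn (K : Finset α) (T' : Table α V) : Prop := (T'.map (proj K)).Nodup

/-- A (complete) table satisfies the functional dependency `X → Y`. -/
def FD (X Y : Finset α) (T' : Table α V) : Prop :=
  ∀ t1 ∈ T', ∀ t2 ∈ T', agrees X t1 t2 → agrees Y t1 t2

/-- A (complete) table over schema `R` satisfies the multivalued dependency `X ↠ Y`. -/
def MVD (R X Y : Finset α) (T' : Table α V) : Prop :=
  ∀ t1 ∈ T', ∀ t2 ∈ T', agrees X t1 t2 →
    ∃ t ∈ T', agrees (X ∪ Y) t t1 ∧ agrees (X ∪ (R \ Y)) t t2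

/-- A (complete) table satisfies the cross join `X × Y`. -/
def CJ (X Y : Finset α) (T' : Table α V) : Prop :=
  ∀ t1 ∈ T', ∀ t2 ∈ T', ∃ t ∈ T', agrees X t t1 ∧ agrees Y t t2

/-- `K` is a strongly possible key of `T`: `sp⟨K⟩`. -/
def spKey (T : Table α V) (K : Finset α) : Prop :=
  ∃ T', spWorld T T' ∧ keyOn K T'

/-- The strongly possible functional dependency `X →_sp Y` holds in `T`. -/
def spFD (T : Table α V) (X Y : Finset α) : Prop :=
  ∃ T', spWorld T T' ∧ FD X Y T'

/-- The strongly possible multivalued dependency `X ↠_sp Y` holds in `T` over schema `R`. -/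
def spMVD (R : Finset α) (T : Table α V) (X Y : Finset α) : Prop :=
  ∃ T', spWorld T T' ∧ MVD R X Y T'

/-- The strongly possible cross join `X ×_sp Y` holds in `T`. -/
def spCJ (T : Table α V) (X Y : Finset α) : Prop :=
  ∃ T', spWorld T T' ∧ CJ X Y T'

/-- Lien's null multivalued dependency `X ↠ Y` over schema `R`. -/
def NMVD (R : Finset α) (T : Table α V) (X Y : Finset α) : Prop :=
  ∀ t1 ∈ T, ∀ t2 ∈ T, isTotal X t1 → isTotal X t2 → agrees X t1 t2 →
    ∃ t ∈ T, agrees (X ∪ Y) t t1 ∧ agrees (X ∪ (R \ Y)) t t2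

/-- The minimum number of tuples whose removal from `T` makes `P` hold
(`T = T₀ + S` means that `S` is a submultiset of `T` and `T₀ = T ∖ S`). -/
noncomputable def g3Card (T : Table α V) (P : Table α V → Prop) : ℕ :=
  sInf {n : ℕ | ∃ T₀ S : Table α V, T = T₀ + S ∧ P T₀ ∧ Multiset.card S = n}

/-- `g3`: the minimum, over submultisets `S` of `T` whose removal makes the
constraint `P` hold, of `|S|/|T|`. -/
noncomputable def g3 (T : Table α V) (P : Table α V → Prop) : ℚ :=
  (g3Card T P : ℚ) / (Multiset.card T : ℚ)

/-- The minimum number of tuples whose addition to `T` makes `P` hold. -/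
noncomputable def g5Card (T : Table α V) (P : Table α V → Prop) : ℕ :=
  sInf {n : ℕ | ∃ S : Table α V, P (T + S) ∧ Multiset.card S = n}

/-- `g5`: the minimum, over finite multisets `S` of tuples whose addition makes
the constraint `P` hold, of `|S|/|T|`. -/
noncomputable def g5 (T : Table α V) (P : Table α V → Prop) : ℚ :=
  (g5Card T P : ℚ) / (Multiset.card T : ℚ)

end SPDB

namespace SPDB

theorem proj_eq_iff {α V : Type} [DecidableEq α] {M : Finset α} {t u : Tuple α V} :
    proj M t = proj M u ↔ agrees M t u := by
  constructor
  · intro h A hA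
    simpa [proj, hA] using congrFun h A
  · intro h
    funext A
    by_cases hA : A ∈ M
    · simp [proj, hA, h A hA]
    · simp [proj, hA]

/-- Either there are `k` distinct values outside `D`, or `k` values exhaust everything outside
`D`. -/
theorem exists_fresh_or_exhaust {V : Type} (D : Finset V) (hD : D.Nonempty) (k : ℕ) :
    ∃ f : Fin k → V, (Function.Injective f ∧ ∀ i, f i ∉ D) ∨ ∀ v, v ∈ D ∨ ∃ i, f i = v := by
  classical
  by_cases h : Nonempty (Fin k ↪ {v // v ∉ D})
  · obtain ⟨e⟩ := h
    exact ⟨fun i => e i, Or.inl ⟨Subtype.val_injective.comp e.injective, fun i => (e i).2⟩⟩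
  · obtain ⟨v₀, hv₀⟩ := hD
    have hfin : Finite {v // v ∉ D} := by
      by_contra hinf
      rw [not_finite_iff_infinite] at hinf
      exact h ⟨Fin.valEmbedding.trans (Infinite.natEmbedding _)⟩
    have := Fintype.ofFinite {v // v ∉ D}
    have hemb : Nonempty ({v // v ∉ D} ↪ Fin k) := by
      apply Function.Embedding.nonempty_of_card_le
      by_contra hlt
      apply h
      apply Function.Embedding.nonempty_of_card_le
      simp only [Fintype.card_fin] at hlt ⊢
      omega
    obtain ⟨g⟩ := hemb
    rcases isEmpty_or_nonempty {v // v ∉ D} with hemp | hne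
    · exact ⟨fun _ => v₀, Or.inr fun v => Or.inl (not_not.1 fun hv => hemp.elim ⟨v, hv⟩)⟩
    · refine ⟨fun i => (Function.invFun g i : {v // v ∉ D}),
        Or.inr fun v => or_iff_not_imp_left.2 fun hv => ?_⟩
      exact ⟨g ⟨v, hv⟩, congrArg Subtype.val (Function.leftInverse_invFun g.injective ⟨v, hv⟩)⟩

variable {α V : Type} [DecidableEq V]

theorem mem_VD {T : Table α V} {A : α} {v : V} : v ∈ VD T A ↔ ∃ t ∈ T, t A = some v := by
  simp [VD]

/-- `x` may occur in column `A` of a strongly possible world of `Q`. -/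
def InDom (Q : Table α V) (A : α) (x : Option V) : Prop :=
  if (VD Q A).Nonempty then ∃ v ∈ VD Q A, x = some v else x = none

theorem inDom_some {Q : Table α V} {A : α} {v : V} (hv : v ∈ VD Q A) : InDom Q A (some v) := by
  have hne : (VD Q A).Nonempty := ⟨v, hv⟩
  simp only [InDom, hne, if_true]
  exact ⟨v, hv, rfl⟩

theorem spExt_iff {Q : Table α V} {t u : Tuple α V} (ht : t ∈ Q) :
    spExt Q t u ↔ (∀ A, t A ≠ none → u A = t A) ∧ ∀ A, InDom Q A (u A) := by
  constructor
  · refine fun h => ⟨fun A => (h A).1, fun A => ?_⟩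
    by_cases hA : t A = none
    · exact (h A).2 hA
    · obtain ⟨v, hv⟩ := Option.ne_none_iff_exists'.1 hA
      have hmem : v ∈ VD Q A := mem_VD.2 ⟨t, ht, hv⟩
      have hne : (VD Q A).Nonempty := ⟨v, hmem⟩
      simp only [InDom, hne, if_true]
      exact ⟨v, hmem, by rw [(h A).1 hA, hv]⟩
  · exact fun h A => ⟨h.1 A, fun _ => h.2 A⟩

/-- The images `w t` of the tuples `t ∈ s` satisfy `X → Y`. -/
def FDOn (s : Set (Tuple α V)) (X Y : Finset α) (w : Tuple α V → Tuple α V) : Prop :=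
  ∀ t₁ ∈ s, ∀ t₂ ∈ s, agrees X (w t₁) (w t₂) → agrees Y (w t₁) (w t₂)

/-- Duplicate tuples may be extended in the same way. -/
theorem spFD_iff {T : Table α V} {X Y : Finset α} :
    spFD T X Y ↔ ∃ w : Tuple α V → Tuple α V,
      (∀ t ∈ T, spExt T t (w t)) ∧ FDOn {t | t ∈ T} X Y w := by
  classical
  constructor
  · rintro ⟨T', hT', hFD⟩
    have h : ∀ t, ∃ t', t ∈ T → t' ∈ T' ∧ spExt T t t' := by
      intro t
      by_cases ht : t ∈ T
      · obtain ⟨t', h1, h2⟩ := Multiset.exists_mem_of_rel_of_mem hT' ht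
        exact ⟨t', fun _ => ⟨h1, h2⟩⟩
      · exact ⟨t, fun h => absurd h ht⟩
    choose w hw using h
    exact ⟨w, fun t ht => (hw t ht).2, fun t₁ h₁ t₂ h₂ =>
      hFD _ (hw t₁ h₁).1 _ (hw t₂ h₂).1⟩
  · rintro ⟨w, hw, hFD⟩
    refine ⟨T.map w, ?_, ?_⟩
    · exact Multiset.rel_map_right.2 (Multiset.rel_refl_of_refl_on hw)
    · intro t₁ h₁ t₂ h₂
      obtain ⟨u₁, hu₁, rfl⟩ := Multiset.mem_map.1 h₁
      obtain ⟨u₂, hu₂, rfl⟩ := Multiset.mem_map.1 h₂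
      exact hFD u₁ hu₁ u₂ hu₂

/-- Values outside the active domains of `Q` can be replaced by default values. -/
theorem exists_spExt_FDOn {Q : Table α V} {X Y : Finset α} {s : Set (Tuple α V)}
    {w : Tuple α V → Tuple α V} (hext : ∀ t ∈ Q, ∀ A, t A ≠ none → w t A = t A)
    (hX : ∀ A ∈ X, (∀ t ∈ s, ∃ v ∈ VD Q A, w t A = some v) ∨ ∀ t ∈ s, w t A = none)
    (hFD : FDOn s X Y w) :
    ∃ w' : Tuple α V → Tuple α V, (∀ t ∈ Q, spExt Q t (w' t)) ∧ FDOn s X Y w' := by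
  classical
  have hd : ∀ A, ∃ x, InDom Q A x := by
    intro A
    by_cases h : (VD Q A).Nonempty
    · obtain ⟨v, hv⟩ := h
      exact ⟨some v, inDom_some hv⟩
    · exact ⟨none, by simp [InDom, h]⟩
  choose d hd using hd
  refine ⟨fun t A => if InDom Q A (w t A) then w t A else d A, fun t ht => ?_, ?_⟩
  · refine (spExt_iff ht).2 ⟨fun A hA => ?_, fun A => ?_⟩
    · obtain ⟨v, hv⟩ := Option.ne_none_iff_exists'.1 hA
      have h1 : w t A = some v := (hext t ht A hA).trans hv
      simp only [h1, inDom_some (mem_VD.2 ⟨t, ht, hv⟩), if_true, hv]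
    · dsimp only
      split_ifs with h
      · exact h
      · exact hd A
  · intro t₁ h₁ t₂ h₂ hag A hA
    have hag' : agrees X (w t₁) (w t₂) := by
      intro B hB
      rcases hX B hB with h | h
      · obtain ⟨v₁, hv₁, e₁⟩ := h t₁ h₁
        obtain ⟨v₂, hv₂, e₂⟩ := h t₂ h₂
        have := hag B hB
        simpa only [e₁, e₂, inDom_some hv₁, inDom_some hv₂, if_true] using this
      · rw [h t₁ h₁, h t₂ h₂]
    have := hFD t₁ h₁ t₂ h₂ hag' A hA
    simp only [this]

/-- Tuples that are null outside `X` and total on `X` can be added without violating `X → Y`. -/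
theorem FDOn.exists_extend {Q T : Table α V} {X Y : Finset α} {w : Tuple α V → Tuple α V}
    (hTQ : ∀ t ∈ T, t ∈ Q) (hadd : ∀ t ∈ Q, t ∉ T → ∀ A, t A ≠ none ↔ A ∈ X)
    (hw : ∀ t ∈ T, spExt Q t (w t)) (hFD : FDOn {t | t ∈ T} X Y w) : spFD Q X Y := by
  classical
  obtain ⟨e, he, -⟩ : ∃ e : Tuple α V → Tuple α V, (∀ t ∈ Q, spExt Q t (e t)) ∧
      FDOn ∅ X Y e :=
    exists_spExt_FDOn (w := id) (fun _ _ _ _ => rfl) (fun _ _ => Or.inl fun _ h => h.elim)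
      (fun _ h => h.elim)
  let P : Tuple α V → Prop := fun r => ∃ t, t ∈ T ∧ agrees X r (w t)
  let w' : Tuple α V → Tuple α V := fun t => if t ∈ T then w t else
    fun A => if A ∈ X then t A else if h : P t then w h.choose A else e t A
  have hT : ∀ t ∈ T, w' t = w t := fun t ht => if_pos ht
  have hX : ∀ r, r ∉ T → ∀ A ∈ X, w' r A = r A := by
    intro r hr A hA
    simp [w', hr, hA]
  have key : ∀ r ∉ T, ∀ t ∈ T, agrees X (w' r) (w t) → agrees Y (w' r) (w t) := by
    intro r hr t ht hag A hA
    by_cases hAX : A ∈ X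
    · exact hag A hAX
    · have hag' : agrees X r (w t) := fun B hB => (hX r hr B hB).symm.trans (hag B hB)
      have hP : P r := ⟨t, ht, hag'⟩
      have h1 : w' r A = w hP.choose A := by simp [w', hr, hAX, hP]
      rw [h1]
      exact hFD _ hP.choose_spec.1 t ht
        (fun B hB => (hP.choose_spec.2 B hB).symm.trans (hag' B hB)) A hA
  refine spFD_iff.2 ⟨w', fun t ht => ?_, ?_⟩
  · by_cases htT : t ∈ T
    · rw [hT t htT]; exact hw t htT
    · refine (spExt_iff ht).2 ⟨fun A hA => hX t htT A ((hadd t ht htT A).1 hA), fun A => ?_⟩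
      by_cases hAX : A ∈ X
      · have h1 := (hadd t ht htT A).2 hAX
        rw [hX t htT A hAX, ← ((spExt_iff ht).1 (he t ht)).1 A h1]
        exact ((spExt_iff ht).1 (he t ht)).2 A
      · by_cases hP : P t
        · have h1 : w' t A = w hP.choose A := by simp [w', htT, hAX, hP]
          rw [h1]
          have h2 := hP.choose_spec.1
          exact ((spExt_iff (hTQ _ h2)).1 (hw _ h2)).2 A
        · have h1 : w' t A = e t A := by simp [w', htT, hAX, hP]
          rw [h1]
          exact ((spExt_iff ht).1 (he t ht)).2 A
  · intro t₁ h₁ t₂ h₂ hag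
    by_cases ht₁ : t₁ ∈ T <;> by_cases ht₂ : t₂ ∈ T
    · rw [hT _ ht₁, hT _ ht₂] at *
      exact hFD _ ht₁ _ ht₂ hag
    · rw [hT _ ht₁] at *
      exact fun A hA => (key _ ht₂ _ ht₁ (fun B hB => (hag B hB).symm) A hA).symm
    · rw [hT _ ht₂] at *
      exact key _ ht₁ _ ht₂ hag
    · have : t₁ = t₂ := by
        funext A
        by_cases hA : A ∈ X
        · rw [← hX _ ht₁ A hA, ← hX _ ht₂ A hA, hag A hA]
        · have a := (hadd t₁ h₁ ht₁ A).not.2 hA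
          have b := (hadd t₂ h₂ ht₂ A).not.2 hA
          rw [not_not.1 a, not_not.1 b]
      rw [this]
      exact fun A _ => rfl

/-- Let `w₀` be a world of `T` which is good on `T₀`, and `w₁` a world which is good on the
`M`-total tuples.  If there are as many fresh values for each attribute of `M` as there are
tuples outside `T₀`, the two worlds can be combined to a good world on all of `T`. -/
theorem FDOn.exists_combine [DecidableEq α] {T T₀ S Q : Table α V} {X Y M : Finset α} {k : ℕ}
    {w₀ w₁ : Tuple α V → Tuple α V} {f : α → Fin k → V}
    (hT : T = T₀ + S) (hk : Multiset.card S = k) (hk0 : 0 < k) (hMX : M ⊆ X)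
    (hTQ : ∀ t ∈ T, t ∈ Q)
    (hinj : ∀ A ∈ M, Function.Injective (f A)) (hfresh : ∀ A ∈ M, ∀ i, f A i ∉ VD T A)
    (hfQ : ∀ A ∈ M, ∀ i, f A i ∈ VD Q A)
    (hw₀ : ∀ t ∈ T, spExt Q t (w₀ t)) (hw₀T : ∀ t ∈ T, ∀ A ∈ M, ∃ v ∈ VD T A, w₀ t A = some v)
    (hw₁ : ∀ t ∈ T, spExt Q t (w₁ t))
    (hFD₀ : FDOn {t | t ∈ T₀} X Y w₀) (hFD₁ : FDOn {t | t ∈ T ∧ isTotal M t} X Y w₁) :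
    ∃ w : Tuple α V → Tuple α V, (∀ t ∈ T, spExt Q t (w t)) ∧ FDOn {t | t ∈ T} X Y w := by
  classical
  let K : Finset (Tuple α V) := S.toFinset.image fun s => if isTotal M s then proj M s else s
  have hK : K.card ≤ k :=
    Finset.card_image_le.trans ((Multiset.toFinset_card_le S).trans hk.le)
  obtain ⟨ix, hix⟩ : ∃ ix : Tuple α V → Fin k, Set.InjOn ix K := by
    obtain ⟨g⟩ : Nonempty (K ↪ Fin k) :=
      Function.Embedding.nonempty_of_card_le (by simpa using hK)
    refine ⟨fun t => if h : t ∈ K then g ⟨t, h⟩ else ⟨0, hk0⟩, fun a ha b hb hab => ?_⟩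
    have ha' : a ∈ K := ha
    have hb' : b ∈ K := hb
    simp only [ha', hb', dif_pos] at hab
    exact congrArg Subtype.val (g.injective hab)
  let key : Tuple α V → Tuple α V := fun t =>
    if isTotal M t ∨ t ∈ T₀ then proj M (w₀ t) else t
  have hext : ∀ t ∈ T, ∀ A, t A ≠ none → w₀ t A = t A := fun t ht A => (hw₀ t ht A).1
  have hkeyT₀ : ∀ t ∈ T, key t ∉ K → t ∈ T₀ := by
    intro t ht hkt
    by_contra hn
    have hS : t ∈ S := by
      rw [hT, Multiset.mem_add] at ht
      exact ht.resolve_left hn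
    apply hkt
    refine Finset.mem_image.2 ⟨t, by simpa using hS, ?_⟩
    by_cases htot : isTotal M t
    · simp only [key, htot, true_or, if_true]
      exact proj_eq_iff.2 fun A hA => (hext t ht A (htot A hA)).symm
    · simp [key, htot, hn]
  let w : Tuple α V → Tuple α V := fun t =>
    if key t ∈ K then
      if isTotal M t then w₁ t
      else fun A => if A ∈ M ∧ t A = none then some (f A (ix (key t))) else w₀ t A
    else w₀ t
  have w_none : ∀ t, key t ∉ K → w t = w₀ t := fun t h => if_neg h
  have w_tot : ∀ t, key t ∈ K → isTotal M t → w t = w₁ t := by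
    intro t h h'; simp [w, h, h']
  have w_null : ∀ t, key t ∈ K → ∀ A ∈ M, t A = none → w t A = some (f A (ix (key t))) := by
    intro t h A hA h'
    have : ¬ isTotal M t := fun ht => ht A hA h'
    simp [w, h, this, hA, h']
  have w_other : ∀ t, key t ∈ K → ¬ isTotal M t → ∀ A, ¬ (A ∈ M ∧ t A = none) →
      w t A = w₀ t A := by
    intro t h h' A hA
    simp only [w, h, h', if_true, if_false, hA]
  have hwext : ∀ t ∈ T, spExt Q t (w t) := by
    intro t ht
    by_cases hkt : key t ∈ K
    · by_cases htot : isTotal M t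
      · rw [w_tot t hkt htot]; exact hw₁ t ht
      · refine (spExt_iff (hTQ t ht)).2 ⟨fun A hA => ?_, fun A => ?_⟩
        · rw [w_other t hkt htot A (fun h => hA h.2)]
          exact hext t ht A hA
        · by_cases hA : A ∈ M ∧ t A = none
          · rw [w_null t hkt A hA.1 hA.2]
            exact inDom_some (hfQ A hA.1 (ix (key t)))
          · rw [w_other t hkt htot A hA]
            exact ((spExt_iff (hTQ t ht)).1 (hw₀ t ht)).2 A
    · rw [w_none t hkt]; exact hw₀ t ht
  have hval : ∀ t ∈ T, ∀ A, t A ≠ none → w t A = t A := fun t ht A => (hwext t ht A).1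
  have hnonnull : ∀ t₁ ∈ T, ∀ t₂ ∈ T, key t₁ ∈ K → ∀ A ∈ M, t₁ A = none →
      w t₁ A = w t₂ A → key t₂ ∈ K ∧ t₂ A = none := by
    intro t₁ h₁ t₂ h₂ hk₁ A hA hn hag
    rw [w_null t₁ hk₁ A hA hn] at hag
    constructor
    · by_contra hk₂
      obtain ⟨v, hv, e⟩ := hw₀T t₂ h₂ A hA
      rw [w_none t₂ hk₂, e] at hag
      exact hfresh A hA _ (Option.some.inj hag ▸ hv)
    · by_contra hn₂
      rw [hval t₂ h₂ A hn₂] at hag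
      exact hfresh A hA _ (mem_VD.2 ⟨t₂, h₂, hag.symm⟩)
  have htotne : ∀ t : Tuple α V, ¬ isTotal M t → ∃ A ∈ M, t A = none := by
    intro t h
    simpa [isTotal] using h
  have mixed : ∀ t₁ ∈ T, ∀ t₂ ∈ T, isTotal M t₁ → ¬ isTotal M t₂ →
      agrees X (w t₁) (w t₂) → agrees Y (w t₁) (w t₂) := by
    intro t₁ h₁ t₂ h₂ htot₁ htot₂ hag
    have hk₂ : key t₂ ∉ K := by
      intro hk₂
      obtain ⟨A, hA, hn⟩ := htotne t₂ htot₂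
      exact htot₁ A hA (hnonnull t₂ h₂ t₁ h₁ hk₂ A hA hn (hag A (hMX hA)).symm).2
    have hm₂ := hkeyT₀ t₂ h₂ hk₂
    have hkeq : key t₁ = key t₂ := by
      simp only [key, htot₁, hm₂, true_or, or_true, if_true]
      refine proj_eq_iff.2 fun A hA => ?_
      rw [hext t₁ h₁ A (htot₁ A hA), ← hval t₁ h₁ A (htot₁ A hA), hag A (hMX hA),
        w_none t₂ hk₂]
    have hk₁ : key t₁ ∉ K := hkeq ▸ hk₂
    rw [w_none t₁ hk₁, w_none t₂ hk₂] at *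
    exact hFD₀ _ (hkeyT₀ t₁ h₁ hk₁) _ hm₂ hag
  refine ⟨w, hwext, fun t₁ h₁ t₂ h₂ hag => ?_⟩
  by_cases htot₁ : isTotal M t₁ <;> by_cases htot₂ : isTotal M t₂
  · have hkeq : key t₁ = key t₂ := by
      simp only [key, htot₁, htot₂, true_or, if_true]
      refine proj_eq_iff.2 fun A hA => ?_
      rw [hext t₁ h₁ A (htot₁ A hA), hext t₂ h₂ A (htot₂ A hA),
        ← hval t₁ h₁ A (htot₁ A hA), ← hval t₂ h₂ A (htot₂ A hA), hag A (hMX hA)]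
    by_cases hk₁ : key t₁ ∈ K
    · have hk₂ : key t₂ ∈ K := hkeq ▸ hk₁
      rw [w_tot t₁ hk₁ htot₁, w_tot t₂ hk₂ htot₂] at *
      exact hFD₁ _ ⟨h₁, htot₁⟩ _ ⟨h₂, htot₂⟩ hag
    · have hk₂ : key t₂ ∉ K := hkeq ▸ hk₁
      rw [w_none t₁ hk₁, w_none t₂ hk₂] at *
      exact hFD₀ _ (hkeyT₀ t₁ h₁ hk₁) _ (hkeyT₀ t₂ h₂ hk₂) hag
  · exact mixed t₁ h₁ t₂ h₂ htot₁ htot₂ hag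
  · exact fun A hA =>
      (mixed t₂ h₂ t₁ h₁ htot₂ htot₁ (fun B hB => (hag B hB).symm) A hA).symm
  · by_cases hk₁ : key t₁ ∈ K
    · obtain ⟨A₀, hA₀, hn₀⟩ := htotne t₁ htot₁
      obtain ⟨hk₂, hn₀'⟩ := hnonnull t₁ h₁ t₂ h₂ hk₁ A₀ hA₀ hn₀ (hag A₀ (hMX hA₀))
      have hnull : ∀ A ∈ M, (t₁ A = none ↔ t₂ A = none) := fun A hA =>
        ⟨fun h => (hnonnull t₁ h₁ t₂ h₂ hk₁ A hA h (hag A (hMX hA))).2,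
          fun h => (hnonnull t₂ h₂ t₁ h₁ hk₂ A hA h (hag A (hMX hA)).symm).2⟩
      have hkeq : key t₁ = key t₂ := by
        have := hag A₀ (hMX hA₀)
        rw [w_null t₁ hk₁ A₀ hA₀ hn₀, w_null t₂ hk₂ A₀ hA₀ hn₀'] at this
        exact hix hk₁ hk₂ (hinj A₀ hA₀ (Option.some.inj this))
      have hprojtot : ∀ t ∈ T, isTotal M (proj M (w₀ t)) := by
        intro t ht A hA
        obtain ⟨v, -, e⟩ := hw₀T t ht A hA
        simp [proj, hA, e]
      by_cases hm₁ : t₁ ∈ T₀ <;> by_cases hm₂ : t₂ ∈ T₀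
      · simp only [key, hm₁, hm₂, or_true, if_true] at hkeq
        have hM := proj_eq_iff.1 hkeq
        have hag₀ : agrees X (w₀ t₁) (w₀ t₂) := by
          intro A hA
          by_cases hAM : A ∈ M
          · exact hM A hAM
          · have := hag A hA
            rwa [w_other t₁ hk₁ htot₁ A (fun h => hAM h.1),
              w_other t₂ hk₂ htot₂ A (fun h => hAM h.1)] at this
        intro A hA
        by_cases hAX : A ∈ X
        · exact hag A hAX
        · have hAM : A ∉ M := fun h => hAX (hMX h)
          rw [w_other t₁ hk₁ htot₁ A (fun h => hAM h.1),
              w_other t₂ hk₂ htot₂ A (fun h => hAM h.1)]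
          exact hFD₀ _ hm₁ _ hm₂ hag₀ A hA
      · simp only [key, hm₁, hm₂, htot₂, or_true, or_false, if_true, if_false] at hkeq
        exact absurd (hkeq ▸ hprojtot t₁ h₁) htot₂
      · simp only [key, hm₁, hm₂, htot₁, or_true, or_false, if_true, if_false] at hkeq
        exact absurd (hkeq ▸ hprojtot t₂ h₂) htot₁
      · simp only [key, hm₁, hm₂, htot₁, htot₂, or_false, if_false] at hkeq
        rw [hkeq]
        exact fun A _ => rfl
    · by_cases hk₂ : key t₂ ∈ K
      · obtain ⟨A, hA, hn⟩ := htotne t₂ htot₂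
        exact absurd (hnonnull t₂ h₂ t₁ h₁ hk₂ A hA hn (hag A (hMX hA)).symm).1 hk₁
      · rw [w_none t₁ hk₁, w_none t₂ hk₂] at *
        exact hFD₀ _ (hkeyT₀ t₁ h₁ hk₁) _ (hkeyT₀ t₂ h₂ hk₂) hag

/-- If `X →_sp Y` can be achieved by adding tuples at all, and also by removing `|S|` tuples, then
it can be achieved by adding `|S|` tuples. -/
theorem exists_add_of_remove [DecidableEq α] {T T₀ S S₁ : Table α V} {X Y : Finset α}
    (hT : T = T₀ + S) (hVD : ∀ A ∈ X, (VD T A).Nonempty)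
    (hT₀ : spFD T₀ X Y) (hS₁ : spFD (T + S₁) X Y) :
    ∃ S' : Table α V, spFD (T + S') X Y ∧ Multiset.card S' = Multiset.card S := by
  classical
  obtain hS | hk := Nat.eq_zero_or_pos (Multiset.card S)
  · rw [Multiset.card_eq_zero] at hS
    subst hS
    exact ⟨0, by simpa [hT] using hT₀, rfl⟩
  by_cases hV : Nonempty V
  swap
  · rw [not_nonempty_iff] at hV
    refine ⟨S, spFD_iff.2 ⟨id, fun t ht => (spExt_iff ht).2 ⟨fun _ _ => rfl, fun A => ?_⟩,
      fun t₁ _ t₂ _ _ A _ => Subsingleton.elim _ _⟩, rfl⟩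
    have h : ¬ (VD (T + S) A).Nonempty := fun ⟨v, _⟩ => hV.elim v
    simp only [InDom, h, if_false]
    exact Subsingleton.elim _ _
  obtain ⟨k, hkS⟩ : ∃ k, Multiset.card S = k := ⟨_, rfl⟩
  rw [hkS] at hk ⊢
  have hf : ∀ A, ∃ f : Fin k → V, A ∈ X →
      (Function.Injective f ∧ ∀ i, f i ∉ VD T A) ∨ ∀ v, v ∈ VD T A ∨ ∃ i, f i = v := by
    intro A
    by_cases hA : A ∈ X
    · obtain ⟨f, hf⟩ := exists_fresh_or_exhaust (VD T A) (hVD A hA) k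
      exact ⟨f, fun _ => hf⟩
    · exact ⟨fun _ => hV.some, fun h => absurd h hA⟩
  choose f hf using hf
  let M := X.filter fun A => Function.Injective (f A) ∧ ∀ i, f A i ∉ VD T A
  let r : Fin k → Tuple α V := fun i A => if A ∈ X then some (f A i) else none
  let S' : Table α V := (Finset.univ : Finset (Fin k)).val.map r
  have hrS : ∀ t, t ∈ S' ↔ ∃ i, r i = t := by simp [S']
  have hTT : ∀ t ∈ T, t ∈ T + S' := fun t ht => Multiset.mem_add.2 (Or.inl ht)
  have hmono : ∀ A, VD T A ⊆ VD (T + S') A := by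
    intro A v hv
    obtain ⟨t, ht, e⟩ := mem_VD.1 hv
    exact mem_VD.2 ⟨t, hTT t ht, e⟩
  have hfQ : ∀ A ∈ X, ∀ i, f A i ∈ VD (T + S') A := by
    intro A hA i
    exact mem_VD.2 ⟨r i, Multiset.mem_add.2 (Or.inr ((hrS _).2 ⟨i, rfl⟩)), by simp [r, hA]⟩
  have hT₀T : ∀ t ∈ T₀, t ∈ T := fun t ht => hT ▸ Multiset.mem_add.2 (Or.inl ht)
  -- a world of `T` that is good on `T₀`
  obtain ⟨u₀, hu₀, hu₀FD⟩ := spFD_iff.1 hT₀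
  obtain ⟨w₀, hw₀, hFD₀⟩ : ∃ w : Tuple α V → Tuple α V, (∀ t ∈ T, spExt T t (w t)) ∧
      FDOn {t | t ∈ T₀} X Y w := by
    refine exists_spExt_FDOn (w := fun t => if t ∈ T₀ then u₀ t else t) ?_ ?_ ?_
    · intro t _ A hA
      by_cases h : t ∈ T₀
      · simp only [h, if_true]
        exact (hu₀ t h A).1 hA
      · simp [h]
    · intro A _
      by_cases hne : (VD T₀ A).Nonempty
      · refine Or.inl fun t ht => ?_
        have ht : t ∈ T₀ := ht
        have := ((spExt_iff ht).1 (hu₀ t ht)).2 A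
        simp only [InDom, hne, if_true] at this
        obtain ⟨v, hv, e⟩ := this
        obtain ⟨t', ht', e'⟩ := mem_VD.1 hv
        exact ⟨v, mem_VD.2 ⟨t', hT₀T t' ht', e'⟩, by simp only [ht, if_true, e]⟩
      · refine Or.inr fun t ht => ?_
        have ht : t ∈ T₀ := ht
        have := ((spExt_iff ht).1 (hu₀ t ht)).2 A
        simp only [InDom, hne, if_false] at this
        simp only [ht, if_true, this]
    · intro t₁ h₁ t₂ h₂ hag
      have h₁' : t₁ ∈ T₀ := h₁
      have h₂' : t₂ ∈ T₀ := h₂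
      simp only [h₁', h₂', if_true] at hag ⊢
      exact hu₀FD t₁ h₁ t₂ h₂ hag
  have hw₀T : ∀ t ∈ T, ∀ A ∈ X, ∃ v ∈ VD T A, w₀ t A = some v := by
    intro t ht A hA
    have := ((spExt_iff ht).1 (hw₀ t ht)).2 A
    simpa only [InDom, hVD A hA, if_true] using this
  have hw₀Q : ∀ t ∈ T, spExt (T + S') t (w₀ t) := by
    intro t ht
    refine (spExt_iff (hTT t ht)).2 ⟨((spExt_iff ht).1 (hw₀ t ht)).1, fun A => ?_⟩
    by_cases hA : A ∈ X
    · obtain ⟨v, hv, e⟩ := hw₀T t ht A hA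
      exact e ▸ inDom_some (hmono A hv)
    · have hVDeq : VD (T + S') A = VD T A := by
        refine (hmono A).antisymm' fun v hv => ?_
        obtain ⟨t', ht', e⟩ := mem_VD.1 hv
        rcases Multiset.mem_add.1 ht' with h | h
        · exact mem_VD.2 ⟨t', h, e⟩
        · obtain ⟨i, rfl⟩ := (hrS _).1 h
          simp [r, hA] at e
      have := ((spExt_iff ht).1 (hw₀ t ht)).2 A
      simpa only [InDom, hVDeq] using this
  -- a world of the enlarged table that is good on the `M`-total tuples of `T`
  obtain ⟨u₁, hu₁, hu₁FD⟩ := spFD_iff.1 hS₁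
  have hTS₁ : ∀ t ∈ T, t ∈ T + S₁ := fun t ht => Multiset.mem_add.2 (Or.inl ht)
  obtain ⟨w₁, hw₁, hFD₁⟩ : ∃ w : Tuple α V → Tuple α V,
      (∀ t ∈ T + S', spExt (T + S') t (w t)) ∧ FDOn {t | t ∈ T ∧ isTotal M t} X Y w := by
    refine exists_spExt_FDOn (w := fun t => if t ∈ T then u₁ t else t) ?_ ?_ ?_
    · intro t _ A hA
      by_cases h : t ∈ T
      · simp only [h, if_true]
        exact (hu₁ t (hTS₁ t h) A).1 hA
      · simp [h]
    · rintro A hA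
      refine Or.inl ?_
      rintro t ⟨ht, htot⟩
      simp only [ht, if_true]
      by_cases hAM : A ∈ M
      · obtain ⟨v, hv⟩ := Option.ne_none_iff_exists'.1 (htot A hAM)
        exact ⟨v, mem_VD.2 ⟨t, hTT t ht, hv⟩, ((hu₁ t (hTS₁ t ht) A).1 (htot A hAM)).trans hv⟩
      · have hex := (hf A hA).resolve_left fun h => hAM (Finset.mem_filter.2 ⟨hA, h⟩)
        have hne : (VD (T + S₁) A).Nonempty := by
          obtain ⟨v, hv⟩ := hVD A hA
          obtain ⟨t', ht', e⟩ := mem_VD.1 hv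
          exact ⟨v, mem_VD.2 ⟨t', hTS₁ t' ht', e⟩⟩
        have := ((spExt_iff (hTS₁ t ht)).1 (hu₁ t (hTS₁ t ht))).2 A
        simp only [InDom, hne, if_true] at this
        obtain ⟨v, -, e⟩ := this
        refine ⟨v, ?_, e⟩
        rcases hex v with h | ⟨i, rfl⟩
        · exact hmono A h
        · exact hfQ A hA i
    · rintro t₁ ⟨h₁, -⟩ t₂ ⟨h₂, -⟩ hag
      simp only [h₁, h₂, if_true] at hag ⊢
      exact hu₁FD t₁ (hTS₁ t₁ h₁) t₂ (hTS₁ t₂ h₂) hag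
  have hMX : M ⊆ X := Finset.filter_subset _ _
  obtain ⟨w, hw, hFD⟩ := FDOn.exists_combine (f := f) hT hkS hk hMX hTT
    (fun A hA => (Finset.mem_filter.1 hA).2.1) (fun A hA => (Finset.mem_filter.1 hA).2.2)
    (fun A hA => hfQ A (hMX hA)) hw₀Q (fun t ht A hA => hw₀T t ht A (hMX hA))
    (fun t ht => hw₁ t (hTT t ht)) hFD₀ hFD₁
  refine ⟨S', hFD.exists_extend hTT (fun t ht htT A => ?_) hw, by simp [S']⟩
  obtain ⟨i, rfl⟩ := (hrS t).1 ((Multiset.mem_add.1 ht).resolve_left htT)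
  simp [r]

end SPDB

open SPDB in
/-- if every attribute of the schema has a non-null value in `T` and the
`X`-total part of `T` satisfies `X →_sp Y`, then `g3(X →_sp Y) ≥ g5(X →_sp Y)`. -/
theorem statement4 {α V : Type} [DecidableEq α] [DecidableEq V]
    (R X Y : Finset α) (hX : X ⊆ R) (hY : Y ⊆ R) (T : Table α V)
    (hVD : ∀ A ∈ R, ∃ t ∈ T, t A ≠ none)
    (htot : spFD (T.filter (isTotal X)) X Y) :
    g5 T (fun U => spFD U X Y) ≤ g3 T (fun U => spFD U X Y) := by
  have hmem : g3Card T (fun U => spFD U X Y) ∈ {n : ℕ | ∃ T₀ S : Table α V,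
      T = T₀ + S ∧ spFD T₀ X Y ∧ Multiset.card S = n} :=
    Nat.sInf_mem ⟨_, 0, T, (zero_add T).symm, ⟨0, Multiset.Rel.zero, by simp [FD]⟩, rfl⟩
  obtain ⟨T₀, S, hT, hT₀, hcard⟩ := hmem
  have hle : g5Card T (fun U => spFD U X Y) ≤ g3Card T (fun U => spFD U X Y) := by
    by_cases hS₁ : ∃ S₁ : Table α V, spFD (T + S₁) X Y
    · obtain ⟨S₁, hS₁⟩ := hS₁
      have hne : ∀ A ∈ X, (VD T A).Nonempty := by
        intro A hA
        obtain ⟨t, ht, h⟩ := hVD A (hX hA)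
        obtain ⟨v, hv⟩ := Option.ne_none_iff_exists'.1 h
        exact ⟨v, mem_VD.2 ⟨t, ht, hv⟩⟩
      obtain ⟨S', hS', hc⟩ := exists_add_of_remove hT hne hT₀ hS₁
      exact Nat.sInf_le ⟨S', hS', hc.trans hcard⟩
    · have h0 : g5Card T (fun U => spFD U X Y) = 0 :=
        Nat.sInf_eq_zero.2 (Or.inr (Set.eq_empty_iff_forall_notMem.2
          fun _ ⟨S₁, h, _⟩ => hS₁ ⟨S₁, h⟩))
      exact h0 ▸ Nat.zero_le _
  unfold g5 g3
  gcongr
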